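/- Let J ⊆ 𝒥 with J Δ (J−1)^{ss} ≠ 𝒥, and write J^δ = J Δ (J−1)^{ss}. Set a = Σ_{j : j+1 ∈ J^δ} (p−1−s^{(J−1)^{ss}}_j)·p^j and b = −Σ_{j=0}^{f−1} s^J_j·p^j. Then in ℤ/pℤ: J(a,b) = (−1)^{1 + Σ_{j : j+1 ∈ J^δ} s^{(J−1)^{ss}}_j} · Π_{j : j+1 ∈ J^δ, j ∉ J^δ} (−(s^{(J−1)^{ss}}_j + 1)) · Π_{j : j+1 ∉ J^δ, j ∈ J^δ} (s^{(J−1)^{ss}}_j + 1)^{−1}. -/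

import Mathlib

open Finset
open scoped symmDiff

def shiftSet (f : ℕ) (J : Finset (ZMod f)) (k : ℤ) : Finset (ZMod f) :=
  J.image (fun j => j + (k : ZMod f))

def deltaSS (f : ℕ) (Jrho J : Finset (ZMod f)) : Finset (ZMod f) :=
  shiftSet f J (-1) ∩ Jrho

def sfun (p f : ℕ) (r : ZMod f → ℤ) (Jrho J : Finset (ZMod f)) (j : ZMod f) : ℤ :=
  if j ∈ J then
    if j + 1 ∈ J then (if j ∈ Jrho then (p : ℤ) - 3 - r j else (p : ℤ) - 1 - r j)
    else r j + 1
  else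
    if j + 1 ∈ J then (p : ℤ) - 2 - r j else r j

def tfun (f : ℕ) (r : ZMod f → ℤ) (Jrho J : Finset (ZMod f)) (j : ZMod f) : ℤ :=
  if j ∈ J then
    if j + 1 ∈ J then (if j ∈ Jrho then r j + 1 else r j)
    else -1
  else
    if j + 1 ∈ J then r j + 1 else 0


/-- The `j`-th base-`p` digit of the representative in `{0,…,q−2}` of `a` mod `q−1`. -/
def dig (p f : ℕ) (a : ℤ) (j : ℕ) : ℕ :=
  ((a % ((p : ℤ) ^ f - 1)).toNat / p ^ j) % p

/-- The integer `u(a,b)`. -/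
def uab (p f : ℕ) (a b : ℤ) : ℤ :=
  (∑ j ∈ Finset.range f,
      ((p : ℤ) - 1 - ((dig p f a j : ℤ) + (dig p f b j : ℤ) - (dig p f (a + b) j : ℤ))))
    / ((p : ℤ) - 1)

/-- The unit `J(a,b)` of `ℤ/pℤ`. -/
noncomputable def Jab (p f : ℕ) [Fact p.Prime] (a b : ℤ) : ZMod p :=
  (-1 : ZMod p) ^ ((f : ℤ) - 1 + uab p f a b) *
    ∏ j ∈ Finset.range f,
      ((Nat.factorial (dig p f a j) : ZMod p) * (Nat.factorial (dig p f b j) : ZMod p) *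
        ((Nat.factorial (dig p f (a + b) j) : ZMod p))⁻¹)



theorem sum_mul_pow_div_pow_mod (p : ℕ) (hp : 0 < p) :
    ∀ (j n : ℕ) (g : ℕ → ℕ), (∀ i, g i < p) → j < n →
      (∑ i ∈ Finset.range n, g i * p ^ i) / p ^ j % p = g j
  | j, 0, _, _, h => absurd h (Nat.not_lt_zero j)
  | j, n + 1, g, hg, h => by
    have hsum : ∑ i ∈ Finset.range (n + 1), g i * p ^ i
        = g 0 + p * ∑ i ∈ Finset.range n, g (i + 1) * p ^ i := by
      rw [Finset.sum_range_succ', Finset.mul_sum, add_comm]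
      congr 1
      · simp
      · exact Finset.sum_congr rfl fun i _ => by ring
    cases j with
    | zero => rw [hsum]; simp [Nat.add_mul_mod_self_left, Nat.mod_eq_of_lt (hg 0)]
    | succ j =>
      rw [hsum, pow_succ', ← Nat.div_div_eq_div_mul, Nat.add_mul_div_left _ _ hp,
        Nat.div_eq_of_lt (hg 0), zero_add]
      exact sum_mul_pow_div_pow_mod p hp j n (fun i => g (i + 1)) (fun i => hg (i + 1)) (by omega)

theorem prod_range_eq_prod_zmod {M : Type*} [CommMonoid M] (f : ℕ) [NeZero f] (F : ℕ → M) :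
    ∏ i ∈ Finset.range f, F i = ∏ j : ZMod f, F j.val := by
  obtain ⟨n, rfl⟩ := Nat.exists_eq_succ_of_ne_zero (NeZero.ne f)
  exact (Fin.prod_univ_eq_prod_range F (n + 1)).symm

theorem sum_range_eq_sum_zmod {M : Type*} [AddCommMonoid M] (f : ℕ) [NeZero f] (F : ℕ → M) :
    ∑ i ∈ Finset.range f, F i = ∑ j : ZMod f, F j.val := by
  obtain ⟨n, rfl⟩ := Nat.exists_eq_succ_of_ne_zero (NeZero.ne f)
  exact (Fin.sum_univ_eq_sum_range F (n + 1)).symm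

/-- The digits of `x` are read off from any congruent expansion with digits less than `p - 1`. -/
theorem dig_eq_of_modEq (p f : ℕ) [NeZero f] (x : ℤ) (d : ZMod f → ℕ)
    (hd : ∀ j, d j + 1 < p)
    (hx : x ≡ ∑ j : ZMod f, (d j : ℤ) * (p : ℤ) ^ j.val [ZMOD (p : ℤ) ^ f - 1]) (j : ZMod f) :
    dig p f x j.val = d j := by
  have hval : ∀ j : ZMod f, ((j.val : ℕ) : ZMod f) = j := fun j => ZMod.natCast_rightInverse j
  have hsum : ∑ j : ZMod f, d j * p ^ j.val = ∑ i ∈ Finset.range f, d (i : ZMod f) * p ^ i := by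
    rw [sum_range_eq_sum_zmod]
    exact Finset.sum_congr rfl fun j _ => by rw [hval]
  have hlt : ∀ n : ℕ, n ≠ 0 → ∑ i ∈ Finset.range n, d (i : ZMod f) * p ^ i + 1 < p ^ n := by
    intro n
    induction n with
    | zero => simp
    | succ n ih =>
      intro _
      rw [Finset.sum_range_succ, pow_succ]
      have h1 := hd (n : ZMod f)
      rcases Nat.eq_zero_or_pos n with rfl | hn
      · simpa using h1
      · have := ih hn.ne'
        nlinarith [Nat.mul_le_mul_right (p ^ n) h1.le]
  have hmod : (x % ((p : ℤ) ^ f - 1)).toNat = ∑ i ∈ Finset.range f, d (i : ZMod f) * p ^ i := by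
    have hcast : ∑ j : ZMod f, (d j : ℤ) * (p : ℤ) ^ j.val
        = ((∑ i ∈ Finset.range f, d (i : ZMod f) * p ^ i : ℕ) : ℤ) := by
      rw [← hsum]; push_cast; rfl
    have hlt' := hlt f (NeZero.ne f)
    zify at hlt'
    rw [hx.eq, hcast, Int.emod_eq_of_lt (by positivity) (by push_cast; linarith), Int.toNat_natCast]
  have hp : 0 < p := by have := hd j; omega
  rw [dig, hmod, sum_mul_pow_div_pow_mod p hp j.val f (fun i => d (i : ZMod f))
    (fun i => by have := hd (i : ZMod f); omega) (ZMod.val_lt j), hval]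

theorem pow_val_add_one_modEq (p f : ℕ) [NeZero f] (j : ZMod f) :
    (p : ℤ) ^ (j + 1).val ≡ (p : ℤ) * (p : ℤ) ^ j.val [ZMOD (p : ℤ) ^ f - 1] := by
  have hval : (j + 1).val = (j.val + 1) % f := by
    rw [ZMod.val_add, ZMod.val_one_eq_one_mod]; simp
  have hone : (p : ℤ) ^ f ≡ 1 [ZMOD (p : ℤ) ^ f - 1] :=
    (Int.modEq_iff_dvd.2 (by simp)).symm
  have hpow := ((hone.pow ((j.val + 1) / f)).mul_left ((p : ℤ) ^ ((j.val + 1) % f))).symm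
  rw [one_pow, mul_one, ← pow_mul, ← pow_add, Nat.mod_add_div, pow_succ'] at hpow
  rwa [hval]

/-- Cyclic carrying does not change the class modulo `p ^ f - 1`. -/
theorem sum_carry_modEq (p f : ℕ) [NeZero f] (ε : ZMod f → ℤ) :
    ∑ j : ZMod f, (p * ε (j + 1) - ε j) * (p : ℤ) ^ j.val ≡ 0 [ZMOD (p : ℤ) ^ f - 1] := by
  have hshift : ∑ j : ZMod f, ε j * (p : ℤ) ^ j.val
      = ∑ j : ZMod f, ε (j + 1) * (p : ℤ) ^ (j + 1).val :=
    (Equiv.sum_comp (Equiv.addRight (1 : ZMod f)) fun j => ε j * (p : ℤ) ^ j.val).symm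
  have hsplit : ∑ j : ZMod f, (p * ε (j + 1) - ε j) * (p : ℤ) ^ j.val
      = ∑ j : ZMod f, ε (j + 1) * (p * (p : ℤ) ^ j.val - (p : ℤ) ^ (j + 1).val) := by
    simp only [sub_mul, mul_sub, Finset.sum_sub_distrib]
    rw [hshift]
    congr 1
    exact Finset.sum_congr rfl fun j _ => by ring
  rw [hsplit]
  exact Int.modEq_zero_iff_dvd.2 (Finset.dvd_sum fun j _ =>
    ((pow_val_add_one_modEq p f j).dvd).mul_left _)

theorem mem_deltaSS (f : ℕ) (Jrho J : Finset (ZMod f)) (j : ZMod f) :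
    j ∈ deltaSS f Jrho J ↔ j + 1 ∈ J ∧ j ∈ Jrho := by
  simp only [deltaSS, shiftSet, Finset.mem_inter, Finset.mem_image]
  refine and_congr_left fun _ => ⟨?_, fun h => ⟨j + 1, h, by simp⟩⟩
  rintro ⟨k, hk, rfl⟩
  simpa using hk

theorem sfun_eq_sfun_deltaSS (p f : ℕ) (r : ZMod f → ℤ) (Jrho J : Finset (ZMod f)) (j : ZMod f) :
    sfun p f r Jrho J j =
      if j + 1 ∈ J ∆ deltaSS f Jrho J then
        if j ∈ J ∆ deltaSS f Jrho J then (p : ℤ) - 1 - sfun p f r Jrho (deltaSS f Jrho J) j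
        else (p : ℤ) - 2 - sfun p f r Jrho (deltaSS f Jrho J) j
      else
        if j ∈ J ∆ deltaSS f Jrho J then sfun p f r Jrho (deltaSS f Jrho J) j + 1
        else sfun p f r Jrho (deltaSS f Jrho J) j := by
  have hK := mem_deltaSS f Jrho J j
  simp only [sfun, Finset.mem_symmDiff]
  by_cases h1 : j ∈ J <;> by_cases h2 : j + 1 ∈ J <;> by_cases h3 : j ∈ Jrho <;>
    by_cases h4 : j + 1 ∈ deltaSS f Jrho J <;> simp [h1, h2, h3, h4, hK] <;> ring

theorem sfun_bounds (p f : ℕ) (r : ZMod f → ℤ) (Jrho J : Finset (ZMod f)) (j : ZMod f)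
    (h₁ : 12 ≤ r j) (h₂ : r j ≤ (p : ℤ) - 15) :
    1 ≤ sfun p f r Jrho J j ∧ sfun p f r Jrho J j + 2 ≤ p := by
  unfold sfun
  split_ifs <;> constructor <;> linarith

theorem factorial_mul_factorial_eq_neg_one_pow (p : ℕ) [Fact p.Prime] (s : ℕ) :
    ∀ t, s + t + 1 = p →
      ((s.factorial : ZMod p) * (t.factorial : ZMod p)) = (-1) ^ (s + 1) := by
  induction s with
  | zero =>
    intro t ht
    have : t = p - 1 := by omega
    simp [this]
  | succ s ih =>
    intro t ht
    have h := ih (t + 1) (by omega)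
    have hp : ((s + t + 2 : ℕ) : ZMod p) = 0 := by
      rw [show s + t + 2 = p by omega]; simp
    push_cast at hp
    rw [Nat.factorial_succ] at h ⊢
    push_cast at h ⊢
    rw [pow_succ, ← h]
    linear_combination (s.factorial : ZMod p) * (t.factorial : ZMod p) * hp

theorem neg_one_zpow_sum {ι K : Type*} [Field K] (S : Finset ι) (g : ι → ℤ) :
    (-1 : K) ^ (∑ i ∈ S, g i) = ∏ i ∈ S, (-1 : K) ^ g i := by
  classical
  induction S using Finset.induction_on with
  | empty => simp
  | insert a S ha ih => rw [Finset.sum_insert ha, Finset.prod_insert ha, zpow_add₀ (by simp), ih]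

/-- The contribution of a single index: `A` and `B` stand for the membership of `j` and `j + 1`
in the symmetric difference. -/
theorem factorial_factor_eq (p : ℕ) [Fact p.Prime] (A B : Prop) [Decidable A] [Decidable B]
    (s x y z : ℕ) (hs : 1 ≤ s) (hsp : s + 2 ≤ p)
    (hx : (x : ℤ) = if B then (p : ℤ) - 1 - s else 0)
    (hy : (y : ℤ) = if B then (if A then (s : ℤ) else s + 1)
      else (if A then (p : ℤ) - 2 - s else (p : ℤ) - 1 - s))
    (hz : (z : ℤ) = if B then 0 else (p : ℤ) - 1 - s) :
    ((x.factorial : ZMod p) * (y.factorial : ZMod p) * (z.factorial : ZMod p)⁻¹) *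
        (-1) ^ (if A then (1 : ℤ) else 0) =
      (if B then (-1 : ZMod p) ^ (s : ℤ) else 1) *
        (if B ∧ ¬A then -((s : ZMod p) + 1) else 1) *
        (if ¬B ∧ A then ((s : ZMod p) + 1)⁻¹ else 1) := by
  have hfac : ∀ n, n < p → (n.factorial : ZMod p) ≠ 0 := fun n hn h => by
    rw [ZMod.natCast_eq_zero_iff, (Fact.out : p.Prime).dvd_factorial] at h
    omega
  by_cases hB : B <;> by_cases hA : A <;> simp only [hA, hB, if_true, if_false, not_true,
    not_false_iff, and_true, and_false, zpow_one, zpow_zero, mul_one,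
    one_mul, zpow_natCast] at *
  · obtain rfl : y = s := by omega
    obtain rfl : z = 0 := by omega
    have := factorial_mul_factorial_eq_neg_one_pow p y x (by omega)
    simp only [Nat.factorial_zero, Nat.cast_one, inv_one, mul_one]
    rw [pow_succ] at this
    linear_combination -this
  · obtain rfl : y = s + 1 := by omega
    obtain rfl : z = 0 := by omega
    have := factorial_mul_factorial_eq_neg_one_pow p s x (by omega)
    simp only [Nat.factorial_zero, Nat.cast_one, inv_one, mul_one, Nat.factorial_succ]
    push_cast
    rw [pow_succ] at this
    linear_combination ((s : ZMod p) + 1) * this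
  · obtain rfl : x = 0 := by omega
    obtain rfl : z = y + 1 := by omega
    have hp : ((y + 1 + (s + 1) : ℕ) : ZMod p) = 0 := by
      rw [show y + 1 + (s + 1) = p by omega]; simp
    push_cast at hp
    have hy0 := hfac y (by omega)
    have hcast : (y : ZMod p) + 1 = -((s : ZMod p) + 1) := by linear_combination hp
    simp only [Nat.factorial_zero, Nat.factorial_succ]
    push_cast
    rw [hcast, mul_inv, inv_neg]
    field_simp
  · obtain rfl : x = 0 := by omega
    obtain rfl : z = y := by omega
    simp [mul_inv_cancel₀ (hfac z (by omega))]

/-- explicit computation of `J(i(χ_J^s), −s^J)`. -/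
theorem statement16 (p f : ℕ) [NeZero f] [Fact p.Prime] (hf : 1 ≤ f)
    (r : ZMod f → ℤ)
    (hr : ∀ j, max 12 (2 * (f : ℤ) + 1) ≤ r j ∧ r j ≤ (p : ℤ) - max 15 (2 * (f : ℤ) + 3))
    (Jrho J : Finset (ZMod f))
    (hJ : J ∆ deltaSS f Jrho J ≠ Finset.univ) :
    Jab p f
      (∑ j ∈ Finset.univ.filter (fun j : ZMod f => j + 1 ∈ J ∆ deltaSS f Jrho J),
        ((p : ℤ) - 1 - sfun p f r Jrho (deltaSS f Jrho J) j) * (p : ℤ) ^ j.val)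
      (-(∑ j : ZMod f, sfun p f r Jrho J j * (p : ℤ) ^ j.val))
    = (-1 : ZMod p) ^
        (1 + ∑ j ∈ Finset.univ.filter (fun j : ZMod f => j + 1 ∈ J ∆ deltaSS f Jrho J),
              sfun p f r Jrho (deltaSS f Jrho J) j) *
      (∏ j ∈ Finset.univ.filter
          (fun j : ZMod f => j + 1 ∈ J ∆ deltaSS f Jrho J ∧ j ∉ J ∆ deltaSS f Jrho J),
        (-((sfun p f r Jrho (deltaSS f Jrho J) j : ZMod p) + 1))) *
      (∏ j ∈ Finset.univ.filter
          (fun j : ZMod f => j + 1 ∉ J ∆ deltaSS f Jrho J ∧ j ∈ J ∆ deltaSS f Jrho J),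
        ((sfun p f r Jrho (deltaSS f Jrho J) j : ZMod p) + 1)⁻¹) := by
  set D := J ∆ deltaSS f Jrho J with hD
  set s := sfun p f r Jrho (deltaSS f Jrho J) with hs
  have hr₁ : ∀ j, 12 ≤ r j := fun j => (le_max_left _ _).trans (hr j).1
  have hr₂ : ∀ j, r j ≤ (p : ℤ) - 15 := fun j =>
    (hr j).2.trans (sub_le_sub_left (le_max_left _ _) _)
  have hsb : ∀ j, 1 ≤ s j ∧ s j + 2 ≤ p := fun j =>
    sfun_bounds p f r Jrho (deltaSS f Jrho J) j (hr₁ j) (hr₂ j)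
  have hJb : ∀ j, 1 ≤ sfun p f r Jrho J j ∧ sfun p f r Jrho J j + 2 ≤ p := fun j =>
    sfun_bounds p f r Jrho J j (hr₁ j) (hr₂ j)
  have hrel : ∀ j, sfun p f r Jrho J j = if j + 1 ∈ D then
      (if j ∈ D then (p : ℤ) - 1 - s j else (p : ℤ) - 2 - s j)
      else (if j ∈ D then s j + 1 else s j) := fun j => sfun_eq_sfun_deltaSS p f r Jrho J j
  have hlift : ∀ d : ZMod f → ℤ, (∀ j, 0 ≤ d j) → ∃ e : ZMod f → ℕ, ∀ j, (e j : ℤ) = d j :=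
    fun d hd => ⟨fun j => (d j).toNat, fun j => Int.toNat_of_nonneg (hd j)⟩
  obtain ⟨σ, hσ⟩ := hlift s fun j => by have := (hsb j).1; omega
  obtain ⟨x, hx⟩ := hlift (fun j => if j + 1 ∈ D then (p : ℤ) - 1 - s j else 0) fun j => by
    have := hsb j; split_ifs <;> omega
  obtain ⟨y, hy⟩ := hlift (fun j => (p : ℤ) - 1 - sfun p f r Jrho J j) fun j => by
    have := hJb j; omega
  obtain ⟨z, hz⟩ := hlift (fun j => if j + 1 ∈ D then 0 else (p : ℤ) - 1 - s j) fun j => by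
    have := hsb j; split_ifs <;> omega
  have hcarry : ∀ j, (x j : ℤ) + y j = z j +
      (p * (if j + 1 ∈ D then 1 else 0) - (if j ∈ D then 1 else 0)) := fun j => by
    rw [hx, hy, hz, hrel]; split_ifs <;> ring
  set a := ∑ j ∈ Finset.univ.filter (fun j : ZMod f => j + 1 ∈ D),
    ((p : ℤ) - 1 - s j) * (p : ℤ) ^ j.val with ha
  set b := -(∑ j : ZMod f, sfun p f r Jrho J j * (p : ℤ) ^ j.val) with hb
  have hax : a = ∑ j, (x j : ℤ) * (p : ℤ) ^ j.val := by
    rw [ha, Finset.sum_filter]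
    exact Finset.sum_congr rfl fun j _ => by rw [hx]; split_ifs <;> simp
  have hby : b ≡ ∑ j, (y j : ℤ) * (p : ℤ) ^ j.val [ZMOD (p : ℤ) ^ f - 1] := by
    have hsum : ∑ j, (y j : ℤ) * (p : ℤ) ^ j.val
        = b + ∑ j : ZMod f, (p * 1 - 1) * (p : ℤ) ^ j.val := by
      rw [hb, ← Finset.sum_neg_distrib, ← Finset.sum_add_distrib]
      exact Finset.sum_congr rfl fun j _ => by rw [hy]; ring
    rw [hsum]
    simpa using ((sum_carry_modEq p f fun _ => 1).add_left b).symm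
  have habz : a + b ≡ ∑ j, (z j : ℤ) * (p : ℤ) ^ j.val [ZMOD (p : ℤ) ^ f - 1] := by
    have hsum : a + ∑ j, (y j : ℤ) * (p : ℤ) ^ j.val = ∑ j, (z j : ℤ) * (p : ℤ) ^ j.val +
        ∑ j, (p * (if j + 1 ∈ D then 1 else 0) - (if j ∈ D then 1 else 0)) * (p : ℤ) ^ j.val := by
      rw [hax, ← Finset.sum_add_distrib, ← Finset.sum_add_distrib]
      exact Finset.sum_congr rfl fun j _ => by rw [← add_mul, hcarry, add_mul]
    have hzero := (sum_carry_modEq p f fun j => if j ∈ D then 1 else 0).add_left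
      (∑ j, (z j : ℤ) * (p : ℤ) ^ j.val)
    rw [add_zero, ← hsum] at hzero
    exact (hby.add_left a).trans hzero
  have hda : ∀ j : ZMod f, dig p f a j.val = x j := dig_eq_of_modEq p f a x
    (fun j => by have := hsb j; have := hx j; split_ifs at this <;> omega) (by rw [hax])
  have hdb : ∀ j : ZMod f, dig p f b j.val = y j := dig_eq_of_modEq p f b y
    (fun j => by have := hJb j; have := hy j; omega) hby
  have hdab : ∀ j : ZMod f, dig p f (a + b) j.val = z j := dig_eq_of_modEq p f (a + b) z
    (fun j => by have := hsb j; have := hz j; split_ifs at this <;> omega) habz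
  have hu : uab p f a b = f - ∑ j, (if j ∈ D then 1 else 0 : ℤ) := by
    have hshift : ∑ j : ZMod f, (if j + 1 ∈ D then 1 else 0 : ℤ)
        = ∑ j : ZMod f, (if j ∈ D then 1 else 0 : ℤ) :=
      Equiv.sum_comp (Equiv.addRight (1 : ZMod f)) fun j => (if j ∈ D then 1 else 0 : ℤ)
    have hnum : ∑ j : ZMod f, ((p : ℤ) - 1 - ((x j : ℤ) + (y j : ℤ) - (z j : ℤ)))
        = ((p : ℤ) - 1) * (f - ∑ j, (if j ∈ D then 1 else 0 : ℤ)) := by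
      calc _ = ∑ j : ZMod f, (((p : ℤ) - 1) - p * (if j + 1 ∈ D then 1 else 0)
            + (if j ∈ D then 1 else 0)) :=
          Finset.sum_congr rfl fun j _ => by rw [hcarry]; ring
        _ = _ := by
          rw [Finset.sum_add_distrib, Finset.sum_sub_distrib, ← Finset.mul_sum, hshift]
          simp only [Finset.sum_const, Finset.card_univ, ZMod.card, nsmul_eq_mul]
          ring
    rw [uab, sum_range_eq_sum_zmod]
    simp only [hda, hdb, hdab]
    rw [hnum, Int.mul_ediv_cancel_left]
    have := hsb 0
    omega
  have hprod := Finset.prod_congr (rfl : (Finset.univ : Finset (ZMod f)) = Finset.univ)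
    fun j _ => factorial_factor_eq p (j ∈ D) (j + 1 ∈ D) (σ j) (x j) (y j) (z j)
      (by have := hsb j; have := hσ j; omega) (by have := hsb j; have := hσ j; omega)
      (by rw [hσ, hx]) (by rw [hσ, hy, hrel]; split_ifs <;> ring) (by rw [hσ, hz])
  simp only [Finset.prod_mul_distrib] at hprod
  have hsign : ∀ n m : ℤ, (-1 : ZMod p) ^ (n - 1 + (n - m)) = -(-1) ^ m := fun n m => by
    rw [show n - 1 + (n - m) = 2 * (n - m - 1) + (m + 1) by ring, zpow_add₀ (by simp),
      zpow_mul, zpow_add₀ (by simp)]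
    simp
  rw [Jab, prod_range_eq_prod_zmod, hu, hsign, neg_one_zpow_sum, zpow_add₀ (by simp), zpow_one,
    neg_one_zpow_sum, Finset.prod_filter, Finset.prod_filter, Finset.prod_filter]
  simp only [hda, hdb, hdab, ← hσ, Int.cast_natCast, Finset.prod_mul_distrib]
  linear_combination -hprod
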